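/- Let A be a normal uniform algebra on a compact Hausdorff space X, and let x and y be distinct points of X. Then (A_x)_y = (A_y)_x = A_x ∩ A_y, where for a normal uniform algebra B on X and z ∈ X, B_z denotes the closed subalgebra cl(J_z(B)) ⊕ ℂ·1 of B formed from the ideal J_z of B. -/

import Mathlib

open WeakDual Topology

set_option synthInstance.maxHeartbeats 400000
set_option maxHeartbeats 1000000
set_option linter.unusedSectionVars false

noncomputable section

variable {X : Type*} [TopologicalSpace X]

/-- A uniform algebra on `X`: a closed point-separating subalgebra of `C(X, ℂ)`
(it automatically contains the constant functions, being a subalgebra). -/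
def IsUniformAlgebra (A : Subalgebra ℂ C(X, ℂ)) : Prop :=
  IsClosed (A : Set C(X, ℂ)) ∧ ∀ x y : X, x ≠ y → ∃ f ∈ A, f x ≠ f y

/-- The character of evaluation at a point `x ∈ X`. -/
def evalChar (A : Subalgebra ℂ C(X, ℂ)) (x : X) : characterSpace ℂ A :=
  ⟨{ toFun := fun f => (f : C(X, ℂ)) x
     map_add' := fun f g => rfl
     map_smul' := fun c f => rfl
     cont := (ContinuousEvalConst.continuous_eval_const x).comp continuous_subtype_val },
   ⟨by
      intro h
      have h1 : ((1 : A) : C(X, ℂ)) x = 0 := DFunLike.congr_fun h 1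
      simp at h1,
    fun f g => rfl⟩⟩

/-- The continuous linear functional on `A` underlying a character,
as an element of the normed dual of `A`. -/
def charDual {A : Type*} [NonUnitalNonAssocSemiring A] [TopologicalSpace A] [Module ℂ A]
    (φ : characterSpace ℂ A) : A →L[ℂ] ℂ := φ.1

/-- The set `J_φ` of elements of `A` whose Gelfand transform vanishes on a
neighborhood of `φ` in the maximal ideal space of `A`. -/
def vanishNearSet (A : Subalgebra ℂ C(X, ℂ)) (φ : characterSpace ℂ A) : Set A :=
  {f | ∃ U ∈ 𝓝 φ, ∀ ψ ∈ U, ψ f = 0}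

/-- `A` is normal on `X`: disjoint closed sets are separated by a `0`-`1` valued
pair of values of some function in `A`. -/
def IsNormalOn (A : Subalgebra ℂ C(X, ℂ)) : Prop :=
  ∀ K₀ K₁ : Set X, IsClosed K₀ → IsClosed K₁ → Disjoint K₀ K₁ →
    ∃ f ∈ A, (∀ x ∈ K₀, f x = 0) ∧ (∀ x ∈ K₁, f x = 1)

/-- `A` is strongly regular at `x`: `J_x` is dense in `M_x`. -/
def StronglyRegularAt (A : Subalgebra ℂ C(X, ℂ)) (x : X) : Prop :=
  {f : A | (f : C(X, ℂ)) x = 0} ⊆ closure (vanishNearSet A (evalChar A x))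

/-- `d` is a point derivation sequence of order `n` at `φ`: `d⁰ = φ` and the
Leibniz identities hold for `1 ≤ k ≤ n` (linearity/continuity of the `d k` is
imposed by the type at which this is used). -/
def IsDerivSeq {A : Type*} [Mul A] (φ : A → ℂ) (n : ℕ∞) (d : ℕ → A → ℂ) : Prop :=
  (∀ f, d 0 f = φ f) ∧
  ∀ k : ℕ, 1 ≤ k → (k : ℕ∞) ≤ n → ∀ f g,
    d k (f * g) = ∑ j ∈ Finset.range (k + 1), d j f * d (k - j) g

variable [CompactSpace X]

/-- `A` has bounded relative units at `x`. -/
def HasBoundedRelativeUnits (A : Subalgebra ℂ C(X, ℂ)) (x : X) : Prop :=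
  ∃ C : ℝ, 0 < C ∧ ∀ K : Set X, IsCompact K → x ∉ K →
    ∃ f : A, f ∈ vanishNearSet A (evalChar A x) ∧
      (∀ y ∈ K, (f : C(X, ℂ)) y = 1) ∧ ‖(f : C(X, ℂ))‖ ≤ C

/-- `x` is a generalized peak point for `A`. -/
def IsGeneralizedPeakPoint (A : Subalgebra ℂ C(X, ℂ)) (x : X) : Prop :=
  ∀ U ∈ 𝓝 x, ∃ f ∈ A, f x = 1 ∧ ‖f‖ = 1 ∧ ∀ y ∉ U, ‖f y‖ < 1

/-- `P` is a Gleason part for `A`: the set of all characters at dual-norm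
distance `< 2` from some fixed character. -/
def IsGleasonPart (A : Subalgebra ℂ C(X, ℂ)) (P : Set (characterSpace ℂ A)) : Prop :=
  ∃ φ : characterSpace ℂ A, P = {ψ | ‖charDual φ - charDual ψ‖ < 2}

/-- The carrier set of Feinstein's algebra `A_x = cl(J_x) ⊕ ℂ·1`. -/
def feinsteinSet (A : Subalgebra ℂ C(X, ℂ)) (x : X) : Set C(X, ℂ) :=
  {h | ∃ g ∈ closure ((fun f : A => (f : C(X, ℂ))) '' vanishNearSet A (evalChar A x)),
    ∃ c : ℂ, h = g + algebraMap ℂ C(X, ℂ) c}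

section Normal

variable [T2Space X]

/-- If `|1 - f| ≤ 1/2` where `g` does not vanish, a character killing `f` kills `g`. -/
lemma characterSpace_apply_eq_zero_of_near_one {B : Subalgebra ℂ C(X, ℂ)}
    (φ : characterSpace ℂ B) {f g : B} (hf : φ f = 0)
    (hfg : ∀ y, (g : C(X, ℂ)) y ≠ 0 → ‖1 - (f : C(X, ℂ)) y‖ ≤ 1 / 2) : φ g = 0 := by
  have hbound (n : ℕ) : ‖g * (1 - f) ^ n‖ ≤ ‖(g : C(X, ℂ))‖ * (1 / 2) ^ n := by
    change ‖(g : C(X, ℂ)) * (1 - (f : C(X, ℂ))) ^ n‖ ≤ ‖(g : C(X, ℂ))‖ * (1 / 2) ^ n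
    rw [ContinuousMap.norm_le _ (by positivity)]
    intro y
    rw [ContinuousMap.mul_apply, ContinuousMap.pow_apply, norm_mul, norm_pow]
    by_cases hy : (g : C(X, ℂ)) y = 0
    · rw [hy, norm_zero, zero_mul]
      positivity
    · exact mul_le_mul ((g : C(X, ℂ)).norm_coe_le_norm y)
        (pow_le_pow_left₀ (norm_nonneg _) (hfg y hy) n) (by positivity) (norm_nonneg _)
  have hlim : Filter.Tendsto (fun n : ℕ => g * (1 - f) ^ n) Filter.atTop (𝓝 0) := by
    have hpow := (tendsto_pow_atTop_nhds_zero_of_lt_one (r := (1 / 2 : ℝ))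
      (by norm_num) (by norm_num)).const_mul ‖(g : C(X, ℂ))‖
    rw [mul_zero] at hpow
    exact squeeze_zero_norm hbound hpow
  have hφ := ((map_continuous φ).tendsto 0).comp hlim
  have hconst : (φ ∘ fun n : ℕ => g * (1 - f) ^ n) = fun _ => φ g := by
    funext n
    rw [Function.comp_apply, map_mul, map_pow, map_sub, map_one, hf, sub_zero, one_pow, mul_one]
  rw [hconst, map_zero] at hφ
  exact tendsto_nhds_unique tendsto_const_nhds hφ

/-- A normal algebra is natural: every character is an evaluation. -/
lemma IsNormalOn.evalChar_surjective {B : Subalgebra ℂ C(X, ℂ)} (hB : IsNormalOn B) :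
    Function.Surjective (evalChar B) := by
  intro φ
  by_contra! hne
  have hsep (x : X) : ∃ f : B, φ f = 0 ∧ (f : C(X, ℂ)) x = 1 := by
    obtain ⟨f, hf⟩ : ∃ f : B, (f : C(X, ℂ)) x ≠ φ f := by
      by_contra! h
      exact hne x (DFunLike.ext _ _ h)
    have hc : (f : C(X, ℂ)) x - φ f ≠ 0 := sub_ne_zero.mpr hf
    refine ⟨((f : C(X, ℂ)) x - φ f)⁻¹ • (f - algebraMap ℂ B (φ f)), ?_, ?_⟩
    · rw [map_smul, map_sub, AlgHomClass.commutes]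
      simp
    · change ((f : C(X, ℂ)) x - φ f)⁻¹ * ((f : C(X, ℂ)) x - φ f) = 1
      exact inv_mul_cancel₀ hc
  have hloc (x : X) : ∃ g : B, φ g = 0 ∧ ∀ᶠ y in 𝓝 x, (g : C(X, ℂ)) y = 1 := by
    obtain ⟨f, hf0, hf1⟩ := hsep x
    have hV : {y | ‖1 - (f : C(X, ℂ)) y‖ < 1 / 2} ∈ 𝓝 x := by
      refine IsOpen.mem_nhds ?_ (by simp [hf1])
      exact isOpen_lt (by fun_prop) continuous_const
    obtain ⟨W, hW, hWc, hWV⟩ := exists_mem_nhds_isClosed_subset hV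
    have hVo : IsOpen {y | ‖1 - (f : C(X, ℂ)) y‖ < 1 / 2} :=
      isOpen_lt (by fun_prop) continuous_const
    obtain ⟨g, hgB, hg0, hg1⟩ := hB _ W hVo.isClosed_compl hWc
      (Set.disjoint_left.mpr fun y hy hyW => hy (hWV hyW))
    refine ⟨⟨g, hgB⟩, characterSpace_apply_eq_zero_of_near_one φ hf0 fun y hy => ?_,
      Filter.mem_of_superset hW hg1⟩
    by_contra! hlt
    exact hy (hg0 y fun h : _ < _ => absurd h (not_lt.mpr hlt.le))
  choose g hg0 hg1 using hloc
  obtain ⟨t, ht⟩ := CompactSpace.elim_nhds_subcover _ hg1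
  have hprod : ∏ x ∈ t, (1 - g x) = 0 := by
    apply Subtype.ext
    ext y
    obtain ⟨x, hx, hxy⟩ := Set.mem_iUnion₂.mp (ht.ge (Set.mem_univ y))
    have hxy : (g x : C(X, ℂ)) y = 1 := hxy
    have : evalChar B y (∏ x ∈ t, (1 - g x)) = 0 := by
      rw [map_prod]
      refine Finset.prod_eq_zero hx ?_
      change 1 - (g x : C(X, ℂ)) y = 0
      rw [hxy, sub_self]
    exact this
  have := congrArg φ hprod
  rw [map_prod, map_zero] at this
  simp [hg0] at this

lemma IsNormalOn.evalChar_injective {B : Subalgebra ℂ C(X, ℂ)} (hB : IsNormalOn B) :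
    Function.Injective (evalChar B) := by
  intro x y h
  by_contra hxy
  obtain ⟨f, hf, h0, h1⟩ := hB {x} {y} isClosed_singleton isClosed_singleton
    (Set.disjoint_singleton.mpr hxy)
  have hfe : f x = f y := DFunLike.congr_fun h (⟨f, hf⟩ : B)
  rw [h0 x rfl, h1 y rfl] at hfe
  exact zero_ne_one hfe

lemma continuous_evalChar (B : Subalgebra ℂ C(X, ℂ)) : Continuous (evalChar B) :=
  Continuous.subtype_mk (WeakDual.continuous_of_continuous_eval
    fun f : B => (f : C(X, ℂ)).continuous) _

/-- The elements of `B` vanishing on a neighborhood of `x` in `X`. -/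
def vanishNearPoint (B : Subalgebra ℂ C(X, ℂ)) (x : X) : Set C(X, ℂ) :=
  {f | f ∈ B ∧ ∀ᶠ y in 𝓝 x, f y = 0}

/-- For a normal algebra, vanishing near `x` in the maximal ideal space and in `X` agree. -/
lemma IsNormalOn.image_vanishNearSet {B : Subalgebra ℂ C(X, ℂ)} (hB : IsNormalOn B) (x : X) :
    (fun f : B => (f : C(X, ℂ))) '' vanishNearSet B (evalChar B x) = vanishNearPoint B x := by
  have hemb : Topology.IsClosedEmbedding (evalChar B) :=
    (continuous_evalChar B).isClosedEmbedding hB.evalChar_injective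
  ext f
  constructor
  · rintro ⟨f, ⟨U, hU, hUf⟩, rfl⟩
    exact ⟨f.2, Filter.mem_of_superset ((continuous_evalChar B).continuousAt hU)
      fun y hy => hUf _ hy⟩
  · rintro ⟨hf, hfx⟩
    rw [Filter.Eventually, hemb.nhds_eq_comap] at hfx
    obtain ⟨U, hU, hUf⟩ := hfx
    refine ⟨⟨f, hf⟩, ⟨U, hU, fun ψ hψ => ?_⟩, rfl⟩
    obtain ⟨y, rfl⟩ := hB.evalChar_surjective ψ
    exact hUf hψ

lemma apply_eq_zero_of_mem_closure_vanishNearPoint {B : Subalgebra ℂ C(X, ℂ)} {x : X}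
    {g : C(X, ℂ)} (hg : g ∈ closure (vanishNearPoint B x)) : g x = 0 :=
  closure_minimal (t := {f : C(X, ℂ) | f x = 0}) (fun _ hf => hf.2.self_of_nhds)
    (isClosed_eq (ContinuousEvalConst.continuous_eval_const x) continuous_const) hg

lemma IsNormalOn.mem_feinsteinSet {B : Subalgebra ℂ C(X, ℂ)} (hB : IsNormalOn B) {x : X}
    {h : C(X, ℂ)} : h ∈ feinsteinSet B x ↔
      h - algebraMap ℂ C(X, ℂ) (h x) ∈ closure (vanishNearPoint B x) := by
  rw [feinsteinSet, hB.image_vanishNearSet]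
  constructor
  · rintro ⟨g, hg, c, rfl⟩
    have hc : (g + algebraMap ℂ C(X, ℂ) c) x = c := by
      simp [apply_eq_zero_of_mem_closure_vanishNearPoint hg]
    rwa [hc, add_sub_cancel_right]
  · exact fun hh => ⟨_, hh, h x, (sub_add_cancel _ _).symm⟩

lemma IsNormalOn.isClosed_feinsteinSet {B : Subalgebra ℂ C(X, ℂ)} (hB : IsNormalOn B) (x : X) :
    IsClosed (feinsteinSet B x) := by
  have : feinsteinSet B x = (fun h : C(X, ℂ) => h - algebraMap ℂ C(X, ℂ) (h x)) ⁻¹'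
      closure (vanishNearPoint B x) := Set.ext fun h => hB.mem_feinsteinSet
  rw [this]
  exact isClosed_closure.preimage (continuous_id.sub
    ((continuous_algebraMap ℂ C(X, ℂ)).comp (ContinuousEvalConst.continuous_eval_const x)))

lemma IsNormalOn.feinsteinSet_subset {B : Subalgebra ℂ C(X, ℂ)} (hB : IsNormalOn B)
    (hcl : IsClosed (B : Set C(X, ℂ))) (x : X) : feinsteinSet B x ⊆ B := by
  intro h hh
  have := closure_minimal (fun f (hf : f ∈ vanishNearPoint B x) => hf.1) hcl
    (hB.mem_feinsteinSet.mp hh)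
  simpa using B.add_mem this (B.algebraMap_mem (h x))

/-- Elements of `B` that are constant near `x` belong to `B_x`. -/
lemma IsNormalOn.mem_feinsteinSet_of_eventually_eq {B : Subalgebra ℂ C(X, ℂ)}
    (hB : IsNormalOn B) {x : X} {h : C(X, ℂ)} (hh : h ∈ B) {c : ℂ}
    (hc : ∀ᶠ y in 𝓝 x, h y = c) : h ∈ feinsteinSet B x := by
  rw [hB.mem_feinsteinSet]
  refine subset_closure ⟨B.sub_mem hh (B.algebraMap_mem _), ?_⟩
  filter_upwards [hc] with y hy
  simp [hy, hc.self_of_nhds]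

/-- If `B` is normal, so is `B_x`. -/
lemma IsNormalOn.of_feinsteinSet {B C : Subalgebra ℂ C(X, ℂ)} (hB : IsNormalOn B) {x : X}
    (hC : (C : Set C(X, ℂ)) = feinsteinSet B x) : IsNormalOn C := by
  have key {K₀ K₁ : Set X} (h₀ : IsClosed K₀) (h₁ : IsClosed K₁) (hd : Disjoint K₀ K₁)
      (hx : x ∉ K₁) : ∃ f ∈ C, (∀ y ∈ K₀, f y = 0) ∧ ∀ y ∈ K₁, f y = 1 := by
    obtain ⟨W, hW, hWc, hWK⟩ := exists_mem_nhds_isClosed_subset (h₁.isOpen_compl.mem_nhds hx)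
    obtain ⟨f, hf, hf0, hf1⟩ := hB (K₀ ∪ W) K₁ (h₀.union hWc) h₁
      (hd.union_left (Set.disjoint_left.mpr hWK))
    refine ⟨f, ?_, fun y hy => hf0 y (.inl hy), hf1⟩
    rw [← SetLike.mem_coe, hC]
    exact hB.mem_feinsteinSet_of_eventually_eq hf
      (Filter.mem_of_superset hW fun y hy => hf0 y (.inr hy))
  intro K₀ K₁ h₀ h₁ hd
  by_cases hx : x ∈ K₁
  · obtain ⟨f, hf, hf0, hf1⟩ := key h₁ h₀ hd.symm fun h => Set.disjoint_left.mp hd h hx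
    exact ⟨1 - f, C.sub_mem C.one_mem hf, fun y hy => by simp [hf1 y hy],
      fun y hy => by simp [hf0 y hy]⟩
  · exact key h₀ h₁ hd hx

/-- `(A_x)_y = A_x ∩ A_y`. -/
lemma IsNormalOn.feinsteinSet_feinsteinSet {A B : Subalgebra ℂ C(X, ℂ)} (hA : IsNormalOn A)
    (hcl : IsClosed (A : Set C(X, ℂ))) {x y : X} (hxy : x ≠ y)
    (hB : (B : Set C(X, ℂ)) = feinsteinSet A x) :
    feinsteinSet B y = feinsteinSet A x ∩ feinsteinSet A y := by
  have hBn : IsNormalOn B := hA.of_feinsteinSet hB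
  have hBcl : IsClosed (B : Set C(X, ℂ)) := hB ▸ hA.isClosed_feinsteinSet x
  have hBA : (B : Set C(X, ℂ)) ⊆ A := hB ▸ hA.feinsteinSet_subset hcl x
  apply Set.Subset.antisymm
  · intro h hh
    refine ⟨hB ▸ hBn.feinsteinSet_subset hBcl y hh, hA.mem_feinsteinSet.mpr ?_⟩
    have hsub : vanishNearPoint B y ⊆ vanishNearPoint A y := fun f hf => ⟨hBA hf.1, hf.2⟩
    exact closure_mono hsub (hBn.mem_feinsteinSet.mp hh)
  · rintro h ⟨hhx, hhy⟩
    rw [hA.mem_feinsteinSet] at hhx hhy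
    rw [hBn.mem_feinsteinSet]
    obtain ⟨U, hU, V, hV, hUc, hVc, hUV⟩ : ∃ U ∈ 𝓝 x, ∃ V ∈ 𝓝 y,
        IsClosed U ∧ IsClosed V ∧ Disjoint U V := by
      obtain ⟨U, hxU, hU, V, hyV, hV, hd⟩ := exists_open_nhds_disjoint_closure hxy
      exact ⟨closure U, Filter.mem_of_superset (hU.mem_nhds hxU) subset_closure,
        closure V, Filter.mem_of_superset (hV.mem_nhds hyV) subset_closure,
        isClosed_closure, isClosed_closure, hd⟩
    obtain ⟨e, he, he0, he1⟩ := hA V U hVc hUc hUV.symm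
    set c : C(X, ℂ) := algebraMap ℂ C(X, ℂ) (h x - h y) with hc
    have hlim : h - algebraMap ℂ C(X, ℂ) (h y) =
        e * ((h - algebraMap ℂ C(X, ℂ) (h x)) + c) +
          (1 - e) * (h - algebraMap ℂ C(X, ℂ) (h y)) := by
      rw [hc, map_sub]
      ring
    rw [hlim]
    refine map_mem_closure₂ (f := fun j i : C(X, ℂ) => e * (j + c) + (1 - e) * i)
      (by fun_prop) hhx hhy ?_
    rintro j ⟨hj, hjx⟩ i ⟨hi, hiy⟩
    refine ⟨?_, ?_⟩
    · rw [← SetLike.mem_coe, hB]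
      refine hA.mem_feinsteinSet_of_eventually_eq (c := h x - h y) ?_ ?_
      · exact A.add_mem (A.mul_mem he (A.add_mem hj (A.algebraMap_mem _)))
          (A.mul_mem (A.sub_mem A.one_mem he) hi)
      · filter_upwards [hjx, hU] with z hz hzU
        simp [hz, he1 z hzU, hc]
    · filter_upwards [hiy, hV] with z hz hzV
      simp [hz, he0 z hzV]

end Normal

/-- For a normal uniform algebra `A` and distinct points `x, y`,
`(A_x)_y = (A_y)_x = A_x ∩ A_y`. -/
theorem feinstein_algebra_comm
    {X : Type*} [TopologicalSpace X] [CompactSpace X] [T2Space X]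
    (A : Subalgebra ℂ C(X, ℂ)) (hA : IsUniformAlgebra A) (hnormal : IsNormalOn A)
    (x y : X) (hxy : x ≠ y)
    (Bx By : Subalgebra ℂ C(X, ℂ))
    (hBx : (Bx : Set C(X, ℂ)) = feinsteinSet A x)
    (hBy : (By : Set C(X, ℂ)) = feinsteinSet A y)
    (Bxy Byx : Subalgebra ℂ C(X, ℂ))
    (hBxy : (Bxy : Set C(X, ℂ)) = feinsteinSet Bx y)
    (hByx : (Byx : Set C(X, ℂ)) = feinsteinSet By x) :
    (Bxy : Set C(X, ℂ)) = (Byx : Set C(X, ℂ)) ∧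
    (Bxy : Set C(X, ℂ)) = (Bx : Set C(X, ℂ)) ∩ (By : Set C(X, ℂ)) := by
  have hx : (Bxy : Set C(X, ℂ)) = (Bx : Set C(X, ℂ)) ∩ (By : Set C(X, ℂ)) := by
    rw [hBxy, hnormal.feinsteinSet_feinsteinSet hA.1 hxy hBx, hBx, hBy]
  have hy : (Byx : Set C(X, ℂ)) = (By : Set C(X, ℂ)) ∩ (Bx : Set C(X, ℂ)) := by
    rw [hByx, hnormal.feinsteinSet_feinsteinSet hA.1 hxy.symm hBy, hBx, hBy]
  exact ⟨by rw [hx, hy, Set.inter_comm], hx⟩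

end
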